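/- arXiv:math/0004187 — 6 statements merged into one kernel-verified Lean document; each statement's English description precedes it below -/
import Mathlib

section
/- For every natural number N and every x ∈ R, the Euler q-binomial formula holds: ∏_{k=0}^{N-1} (1 − q^k·x) = Σ_{ℓ=0}^{N} [N,ℓ]_q · (−1)^ℓ · q^{ℓ(ℓ−1)/2} · x^ℓ. -/
/-- The Gaussian (`q`-binomial) coefficient `[n, k]_q`, defined by the recurrence
`[n, 0]_q = 1`, `[0, k+1]_q = 0`, `[n+1, k+1]_q = [n, k]_q + q^(k+1) * [n, k+1]_q`
(so that `[n+1, k]_q = [n, k-1]_q + q^k * [n, k]_q` and `[n, k]_q = 0` for `k > n`). -/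
def qBinom {R : Type*} [CommRing R] (q : R) : ℕ → ℕ → R
  | _, 0 => 1
  | 0, _ + 1 => 0
  | n + 1, k + 1 => qBinom q n k + q ^ (k + 1) * qBinom q n (k + 1)

theorem qBinom_zero_right {R : Type*} [CommRing R] (q : R) (n : ℕ) : qBinom q n 0 = 1 := by
  cases n <;> rfl

theorem qBinom_succ_succ {R : Type*} [CommRing R] (q : R) (n k : ℕ) :
    qBinom q (n + 1) (k + 1) = qBinom q n k + q ^ (k + 1) * qBinom q n (k + 1) := rfl

theorem qBinom_eq_zero_of_lt {R : Type*} [CommRing R] (q : R) {n k : ℕ} (h : n < k) :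
    qBinom q n k = 0 := by
  induction n generalizing k with
  | zero =>
    obtain ⟨k, rfl⟩ := Nat.exists_eq_succ_of_ne_zero h.ne'
    rfl
  | succ n ih =>
    obtain ⟨k, rfl⟩ := Nat.exists_eq_succ_of_ne_zero (Nat.ne_zero_of_lt h)
    rw [Nat.succ_eq_add_one, qBinom_succ_succ, ih (by lia), ih (by lia)]
    simp

/-- Euler's `q`-binomial formula:
`∏_{k=0}^{N-1} (1 - q^k x) = ∑_{ℓ=0}^{N} [N,ℓ]_q (-1)^ℓ q^{ℓ(ℓ-1)/2} x^ℓ`. -/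
theorem euler_q_binomial {R : Type*} [CommRing R] (q : R) (N : ℕ) (x : R) :
    ∏ k ∈ Finset.range N, (1 - q ^ k * x) =
      ∑ ℓ ∈ Finset.range (N + 1),
        qBinom q N ℓ * (-1) ^ ℓ * q ^ (ℓ * (ℓ - 1) / 2) * x ^ ℓ := by
  induction N generalizing x with
  | zero => simp [qBinom_zero_right]
  | succ N ih =>
    have hprod : ∏ k ∈ Finset.range (N + 1), (1 - q ^ k * x) =
        (∏ k ∈ Finset.range N, (1 - q ^ k * (q * x))) * (1 - x) := by
      rw [Finset.prod_range_succ']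
      simp only [pow_succ, mul_assoc, pow_zero, one_mul]
    rw [hprod, ih (q * x)]
    set g : ℕ → R := fun ℓ =>
      qBinom q N ℓ * (-1) ^ ℓ * q ^ (ℓ * (ℓ - 1) / 2) * (q * x) ^ ℓ with hg
    have hterm (ℓ : ℕ) : qBinom q (N + 1) (ℓ + 1) * (-1) ^ (ℓ + 1) *
        q ^ ((ℓ + 1) * (ℓ + 1 - 1) / 2) * x ^ (ℓ + 1) = g (ℓ + 1) - g ℓ * x := by
      have hexp : (ℓ + 1) * (ℓ + 1 - 1) / 2 = ℓ * (ℓ - 1) / 2 + ℓ := by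
        simpa [Finset.sum_range_id] using Finset.sum_range_succ (fun i : ℕ => i) ℓ
      simp only [hg, qBinom_succ_succ, hexp]
      ring
    have hshift : ∑ ℓ ∈ Finset.range (N + 1), g (ℓ + 1) + 1 =
        ∑ ℓ ∈ Finset.range (N + 1), g ℓ := by
      have hfirst : g 0 = 1 := by simp [hg, qBinom_zero_right]
      have hlast : g (N + 1) = 0 := by
        simp [hg, qBinom_eq_zero_of_lt q (Nat.lt_succ_self N)]
      rw [← hfirst, ← Finset.sum_range_succ', Finset.sum_range_succ, hlast, add_zero]
    rw [Finset.sum_range_succ' _ (N + 1), Finset.sum_congr rfl fun ℓ _ => hterm ℓ,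
      Finset.sum_sub_distrib, ← Finset.sum_mul]
    simp only [qBinom_zero_right, pow_zero, zero_mul, Nat.zero_div, mul_one]
    change (∑ ℓ ∈ Finset.range (N + 1), g ℓ) * (1 - x) = _
    linear_combination -hshift
end

section
/- (Gauss) For every natural number m, the alternating sum of q-binomial coefficients of even order equals a product of odd-exponent factors: Σ_{ℓ=0}^{2m+2} [2m+2,ℓ]_q · (−1)^ℓ = ∏_{t=0}^{m} (1 − q^{2t+1}). -/
/-- The Rogers–Szegő polynomial `∑ [n, k]_q x ^ k`. -/
def rogersSzego {R : Type*} [CommRing R] (q : R) (n : ℕ) (x : R) : R :=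
  ∑ k ∈ Finset.range (n + 1), qBinom q n k * x ^ k

theorem rogersSzego_zero {R : Type*} [CommRing R] (q x : R) : rogersSzego q 0 x = 1 := by
  simp [rogersSzego, qBinom]

theorem rogersSzego_succ {R : Type*} [CommRing R] (q : R) (n : ℕ) (x : R) :
    rogersSzego q (n + 1) x = x * rogersSzego q n x + rogersSzego q n (q * x) := by
  have h : rogersSzego q n (q * x) =
      ∑ k ∈ Finset.range (n + 1), qBinom q n (k + 1) * (q * x) ^ (k + 1) + 1 := by
    have h0 : qBinom q n 0 = 1 := by simp [qBinom]
    have := Finset.sum_range_succ' (fun k => qBinom q n k * (q * x) ^ k) (n + 1)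
    rw [Finset.sum_range_succ, qBinom_eq_zero_of_lt q (Nat.lt_succ_self n)] at this
    simpa [rogersSzego, h0] using this
  rw [h, rogersSzego, Finset.sum_range_succ', rogersSzego, Finset.mul_sum, ← add_assoc,
    ← Finset.sum_add_distrib]
  congr 1
  · refine Finset.sum_congr rfl fun k _ => ?_
    rw [qBinom]
    ring
  · simp [qBinom]

theorem rogersSzego_succ_mul {R : Type*} [CommRing R] (q : R) (n : ℕ) (x : R) :
    rogersSzego q (n + 1) (q * x) =
      rogersSzego q (n + 1) x - (1 - q ^ (n + 1)) * x * rogersSzego q n x := by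
  induction n generalizing x with
  | zero =>
    simp only [rogersSzego_succ, rogersSzego_zero]
    ring
  | succ n ih =>
    rw [rogersSzego_succ q (n + 1) (q * x), rogersSzego_succ q (n + 1) x]
    linear_combination ih (q * x) + q * x * ih x +
      (1 - q ^ (n + 1)) * q * x * rogersSzego_succ q n x

theorem rogersSzego_add_two_neg_one {R : Type*} [CommRing R] (q : R) (n : ℕ) :
    rogersSzego q (n + 2) (-1) = (1 - q ^ (n + 1)) * rogersSzego q n (-1) := by
  rw [rogersSzego_succ, rogersSzego_succ_mul]
  ring

/-- Gauss: the alternating sum of `q`-binomial coefficients of even order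
equals `(1-q)(1-q^3)⋯(1-q^{2m+1})`. -/
theorem gauss_alternating_sum_even {R : Type*} [CommRing R] (q : R) (m : ℕ) :
    ∑ ℓ ∈ Finset.range (2 * m + 2 + 1), qBinom q (2 * m + 2) ℓ * (-1) ^ ℓ =
      ∏ t ∈ Finset.range (m + 1), (1 - q ^ (2 * t + 1)) := by
  change rogersSzego q (2 * m + 2) (-1) = _
  induction m with
  | zero => simp [rogersSzego_add_two_neg_one, rogersSzego_zero]
  | succ m ih =>
    rw [rogersSzego_add_two_neg_one, Finset.prod_range_succ, ← ih, mul_comm]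
    rfl
end

section
/- For every natural number N: Σ_{k=0}^{⌊N/2⌋} [⌊N/2⌋,k]_{q²} · q^{(N−2k)(N−2k−1)/2} · (∏_{j=0}^{k−1} (1 − q^{N−ε(N)−2j})) = 1, where ε(N) = 1 if N is even and ε(N) = 0 if N is odd. -/
/-- Summation form of the Pascal rule for Gaussian coefficients. -/
theorem sum_qBinom_succ_mul {R : Type*} [CommRing R] (q : R) (n : ℕ) (f : ℕ → R) :
    ∑ k ∈ Finset.range (n + 2), qBinom q (n + 1) k * f k =
      ∑ k ∈ Finset.range (n + 1), qBinom q n k * f (k + 1) +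
        ∑ k ∈ Finset.range (n + 1), qBinom q n k * (q ^ k * f k) := by
  have h : ∑ k ∈ Finset.range (n + 1), qBinom q n k * (q ^ k * f k) =
      ∑ k ∈ Finset.range (n + 2), qBinom q n k * (q ^ k * f k) := by
    rw [Finset.sum_range_succ _ (n + 1), qBinom_eq_zero_of_lt q n.lt_succ_self, zero_mul, add_zero]
  rw [h, Finset.sum_range_succ' _ (n + 1), Finset.sum_range_succ' _ (n + 1), ← add_assoc,
    ← Finset.sum_add_distrib]
  congr 1
  · refine Finset.sum_congr rfl fun k _ => ?_
    change (qBinom q n k + q ^ (k + 1) * qBinom q n (k + 1)) * f (k + 1) = _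
    ring
  · simp [qBinom_zero_right]

/-- The identity `∑ k, [n, k]_q q^{(n-k)(n-k-1)} y^{n-k} ∏_{j<k} (1 - y q^{n-1-j}) = 1`. -/
theorem sum_qBinom_mul_prod_one_sub {R : Type*} [CommRing R] (q y : R) (n : ℕ) :
    ∑ k ∈ Finset.range (n + 1), qBinom q n k *
      (q ^ ((n - k) * (n - k - 1)) * y ^ (n - k) *
        ∏ j ∈ Finset.range k, (1 - y * q ^ (n - 1 - j))) = 1 := by
  induction n generalizing y with
  | zero => simp [qBinom_zero_right]
  | succ n ih =>
    rw [sum_qBinom_succ_mul]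
    have h₁ : ∑ k ∈ Finset.range (n + 1), qBinom q n k *
        (q ^ ((n + 1 - (k + 1)) * (n + 1 - (k + 1) - 1)) * y ^ (n + 1 - (k + 1)) *
          ∏ j ∈ Finset.range (k + 1), (1 - y * q ^ (n + 1 - 1 - j))) = 1 - y * q ^ n := by
      refine Eq.trans ?_ ((congrArg ((1 - y * q ^ n) * ·) (ih y)).trans (mul_one _))
      rw [Finset.mul_sum]
      refine Finset.sum_congr rfl fun k _ => ?_
      have hp : ∏ j ∈ Finset.range k, (1 - y * q ^ (n - (j + 1))) =
          ∏ j ∈ Finset.range k, (1 - y * q ^ (n - 1 - j)) :=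
        Finset.prod_congr rfl fun j _ => by rw [Nat.sub_sub, add_comm 1 j]
      rw [Finset.prod_range_succ', Nat.add_sub_add_right, Nat.add_sub_cancel, hp, Nat.sub_zero]
      ring
    have h₂ : ∑ k ∈ Finset.range (n + 1), qBinom q n k * (q ^ k *
        (q ^ ((n + 1 - k) * (n + 1 - k - 1)) * y ^ (n + 1 - k) *
          ∏ j ∈ Finset.range k, (1 - y * q ^ (n + 1 - 1 - j)))) = y * q ^ n := by
      refine Eq.trans ?_ ((congrArg ((y * q ^ n) * ·) (ih (y * q))).trans (mul_one _))
      rw [Finset.mul_sum]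
      refine Finset.sum_congr rfl fun k hk => ?_
      obtain ⟨m, rfl⟩ := Nat.exists_eq_add_of_le (Finset.mem_range_succ_iff.mp hk)
      have hp : ∏ j ∈ Finset.range k, (1 - y * q ^ (k + m + 1 - 1 - j)) =
          ∏ j ∈ Finset.range k, (1 - y * q * q ^ (k + m - 1 - j)) := by
        refine Finset.prod_congr rfl fun j hj => ?_
        have hj := Finset.mem_range.mp hj
        rw [mul_assoc, ← pow_succ', show k + m - 1 - j + 1 = k + m + 1 - 1 - j by omega]
      rw [hp, show k + m + 1 - k = m + 1 by omega, Nat.add_sub_cancel_left, Nat.add_sub_cancel]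
      have he : q ^ ((m + 1) * m) = q ^ (m * (m - 1)) * q ^ m * q ^ m := by
        rw [← pow_add, ← pow_add]
        congr 1
        cases m with
        | zero => rfl
        | succ m => rw [Nat.add_sub_cancel]; ring
      rw [he]
      ring
    rw [h₁, h₂, sub_add_cancel]

/-- Formula (1.33):
`∑_{k=0}^{⌊N/2⌋} [⌊N/2⌋,k]_{q²} q^{\binom{N-2k}{2}} (q^{N-ε(N)}; q^{-2})_k = 1`. -/
theorem gauss_identity_at_zero {R : Type*} [CommRing R] (q : R) (N : ℕ) :
    ∑ k ∈ Finset.range (N / 2 + 1),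
        qBinom (q ^ 2) (N / 2) k *
          q ^ ((N - 2 * k) * (N - 2 * k - 1) / 2) *
          (∏ j ∈ Finset.range k, (1 - q ^ (N - (if Even N then 1 else 0) - 2 * j))) = 1 := by
  obtain ⟨n, rfl | rfl⟩ := Nat.even_or_odd' N
  · have hn : 2 * n / 2 = n := by omega
    rw [hn, if_pos (even_two_mul n)]
    refine Eq.trans ?_ (sum_qBinom_mul_prod_one_sub (q ^ 2) q n)
    refine Finset.sum_congr rfl fun k hk => ?_
    obtain ⟨m, rfl⟩ := Nat.exists_eq_add_of_le (Finset.mem_range_succ_iff.mp hk)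
    rw [mul_assoc]
    congr 2
    · rw [← pow_mul, ← pow_add]
      congr 1
      rw [show 2 * (k + m) - 2 * k = 2 * m by omega, Nat.add_sub_cancel_left, mul_assoc,
        Nat.mul_div_cancel_left _ two_pos]
      cases m with
      | zero => rfl
      | succ m =>
        rw [show 2 * (m + 1) - 1 = 2 * m + 1 by omega, Nat.add_sub_cancel]
        ring
    · refine Finset.prod_congr rfl fun j hj => ?_
      have hj := Finset.mem_range.mp hj
      rw [← pow_mul, ← pow_succ', show 2 * (k + m) - 1 - 2 * j = 2 * (k + m - 1 - j) + 1 by omega]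
  · have hn : (2 * n + 1) / 2 = n := by omega
    rw [hn, if_neg (Nat.not_even_two_mul_add_one n)]
    refine Eq.trans ?_ (sum_qBinom_mul_prod_one_sub (q ^ 2) (q ^ 3) n)
    refine Finset.sum_congr rfl fun k hk => ?_
    obtain ⟨m, rfl⟩ := Nat.exists_eq_add_of_le (Finset.mem_range_succ_iff.mp hk)
    rw [mul_assoc]
    congr 2
    · rw [← pow_mul, ← pow_mul, ← pow_add]
      congr 1
      rw [show 2 * (k + m) + 1 - 2 * k = 2 * m + 1 by omega, Nat.add_sub_cancel_left,
        Nat.add_sub_cancel, mul_left_comm, Nat.mul_div_cancel_left _ two_pos]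
      cases m with
      | zero => rfl
      | succ m =>
        rw [Nat.add_sub_cancel]
        ring
    · refine Finset.prod_congr rfl fun j hj => ?_
      have hj := Finset.mem_range.mp hj
      rw [← pow_mul, ← pow_add,
        show 2 * (k + m) + 1 - 0 - 2 * j = 3 + 2 * (k + m - 1 - j) by omega]
end

section
/- Let 𝒪 be the operator sending a polynomial function f of x to 𝒪(f)(x) = x·f(x) − f(q·x). Then for every natural number s ≥ 1 and every x ∈ R: x·(x ∸ 1)^s − ∏_{k=0}^{s−1}(q·x − q^k) = (x ∸ 1)^{s+1} + q^{s−1}·(1 − q^s)·(x ∸ 1)^{s−1}, where (x ∸ 1)^ℓ := ∏_{k=0}^{ℓ−1} (x − q^k). -/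
/-- Dilating the argument of the `q`-shifted power by `q`. -/
theorem prod_range_succ_mul_sub_pow {R : Type*} [CommRing R] (q x : R) (n : ℕ) :
    ∏ k ∈ Finset.range (n + 1), (q * x - q ^ k) =
      (q * x - 1) * q ^ n * ∏ k ∈ Finset.range n, (x - q ^ k) := by
  induction n with
  | zero => simp
  | succ n ih =>
    rw [Finset.prod_range_succ, ih, Finset.prod_range_succ _ n]
    ring


/-- Formula (2.17): for `s ≥ 1`, with `(x ∸ 1)^ℓ := ∏_{k=0}^{ℓ-1} (x - q^k)`,
`x (x ∸ 1)^s - ∏_{k=0}^{s-1} (qx - q^k)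
  = (x ∸ 1)^{s+1} + q^{s-1} (1 - q^s) (x ∸ 1)^{s-1}`. -/
theorem qShiftedPower_op {R : Type*} [CommRing R] (q : R) (s : ℕ) (hs : 1 ≤ s) (x : R) :
    x * (∏ k ∈ Finset.range s, (x - q ^ k)) -
        ∏ k ∈ Finset.range s, (q * x - q ^ k) =
      (∏ k ∈ Finset.range (s + 1), (x - q ^ k)) +
        q ^ (s - 1) * (1 - q ^ s) * ∏ k ∈ Finset.range (s - 1), (x - q ^ k) := by
  obtain ⟨n, rfl⟩ := Nat.exists_eq_add_of_le' hs
  rw [prod_range_succ_mul_sub_pow, Nat.add_sub_cancel, Finset.prod_range_succ _ (n + 1),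
    Finset.prod_range_succ _ n]
  ring
end

section
/- (q-Taylor expansion of a monomial) For all natural numbers n and all a, x ∈ R: x^n = Σ_{k=0}^{n} [n,k]_q · a^{n−k} · ∏_{i=0}^{k−1} (x − q^i·a). -/
/-- `q`-Taylor expansion of a monomial (3.6):
`x^n = ∑_{k=0}^{n} [n,k]_q a^{n-k} ∏_{i=0}^{k-1} (x - q^i a)`. -/
theorem qTaylor_monomial {R : Type*} [CommRing R] (q : R) (n : ℕ) (a x : R) :
    x ^ n =
      ∑ k ∈ Finset.range (n + 1),
        qBinom q n k * a ^ (n - k) * ∏ i ∈ Finset.range k, (x - q ^ i * a) := by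
  induction n with
  | zero => simp [qBinom_zero_right]
  | succ n ih =>
    have h_shift : ∑ k ∈ Finset.range (n + 1), q ^ (k + 1) * qBinom q n (k + 1) * a ^ (n - k) *
          ∏ i ∈ Finset.range (k + 1), (x - q ^ i * a) + a ^ (n + 1) =
        ∑ k ∈ Finset.range (n + 1), q ^ k * qBinom q n k * a ^ (n + 1 - k) *
          ∏ i ∈ Finset.range k, (x - q ^ i * a) := by
      have h := Finset.sum_range_succ' (fun k ↦ q ^ k * qBinom q n k * a ^ (n + 1 - k) *
        ∏ i ∈ Finset.range k, (x - q ^ i * a)) (n + 1)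
      rw [Finset.sum_range_succ, qBinom_eq_zero_of_lt q n.lt_succ_self] at h
      simpa [qBinom_zero_right] using h.symm
    rw [Finset.sum_range_succ', pow_succ, ih, Finset.sum_mul]
    simp only [qBinom_succ_succ, qBinom_zero_right, add_mul, Finset.sum_add_distrib,
      Nat.add_sub_add_right, Nat.sub_zero, Finset.prod_range_zero, one_mul, mul_one]
    rw [add_assoc, h_shift, ← Finset.sum_add_distrib]
    refine Finset.sum_congr rfl fun k hk ↦ ?_
    rw [Nat.sub_add_comm (Finset.mem_range_succ_iff.mp hk), Finset.prod_range_succ]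
    ring
end

section
/- For all natural numbers N and k with 2k ≤ N: [N,2k]_q · ∏_{j=0}^{k−1}(1 − q^{2j+1}) = [⌊N/2⌋,k]_{q²} · ∏_{j=0}^{k−1}(1 − q^{N−ε(N)−2j}), where ε(N) = 1 if N is even and ε(N) = 0 if N is odd. -/
theorem map_qBinom {R S : Type*} [CommRing R] [CommRing S] (f : R →+* S) (q : R) (n k : ℕ) :
    f (qBinom q n k) = qBinom (f q) n k := by
  induction n generalizing k with
  | zero => cases k <;> simp [qBinom]
  | succ n ih => cases k <;> simp [qBinom, ih]

/-- The product formula for Gaussian coefficients, with denominators cleared. -/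
theorem qBinom_mul_prod {R : Type*} [CommRing R] (q : R) (n k : ℕ) :
    qBinom q n k * ∏ j ∈ Finset.range k, (1 - q ^ (j + 1)) =
      ∏ j ∈ Finset.range k, (1 - q ^ (n - j)) := by
  induction n generalizing k with
  | zero =>
    cases k with
    | zero => simp [qBinom]
    | succ k => simp [qBinom]
  | succ n ih =>
    cases k with
    | zero => simp [qBinom]
    | succ k =>
      have h₁ := ih k
      have h₂ := ih (k + 1)
      have h₃ : ∏ j ∈ Finset.range (k + 1), (1 - q ^ (n + 1 - j)) =
          (∏ j ∈ Finset.range k, (1 - q ^ (n - j))) * (1 - q ^ (n + 1)) := by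
        rw [Finset.prod_range_succ']
        simp
      have h₄ : (∏ j ∈ Finset.range k, (1 - q ^ (n - j))) * (q ^ (k + 1) * q ^ (n - k)) =
          (∏ j ∈ Finset.range k, (1 - q ^ (n - j))) * q ^ (n + 1) := by
        rcases le_or_gt k n with h | h
        · rw [← pow_add, show k + 1 + (n - k) = n + 1 by omega]
        · rw [Finset.prod_eq_zero (Finset.mem_range.2 h) (by simp), zero_mul, zero_mul]
      rw [h₃]
      rw [Finset.prod_range_succ] at h₂ ⊢
      rw [Finset.prod_range_succ _ k] at h₂
      simp only [qBinom]
      linear_combination (1 - q ^ (k + 1)) * h₁ + q ^ (k + 1) * h₂ - h₄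

theorem prod_range_two_mul {M : Type*} [CommMonoid M] (f : ℕ → M) (k : ℕ) :
    ∏ j ∈ Finset.range (2 * k), f j =
      (∏ j ∈ Finset.range k, f (2 * j)) * ∏ j ∈ Finset.range k, f (2 * j + 1) := by
  induction k with
  | zero => simp
  | succ k ih =>
    rw [Nat.mul_succ, Finset.prod_range_succ, Finset.prod_range_succ, ih,
      Finset.prod_range_succ, Finset.prod_range_succ]
    exact (mul_assoc _ _ _).trans (mul_mul_mul_comm _ _ _ _)

theorem qBinom_two_mul_eq_mul_prod {R : Type*} [CommRing R] (q : R) (N k : ℕ) :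
    (qBinom q N (2 * k) * ∏ j ∈ Finset.range k, (1 - q ^ (2 * j + 1))) *
        ∏ j ∈ Finset.range k, (1 - (q ^ 2) ^ (j + 1)) =
      (qBinom (q ^ 2) (N / 2) k *
        ∏ j ∈ Finset.range k, (1 - q ^ (N - (if Even N then 1 else 0) - 2 * j))) *
        ∏ j ∈ Finset.range k, (1 - (q ^ 2) ^ (j + 1)) := by
  have h₁ := qBinom_mul_prod q N (2 * k)
  have h₂ := qBinom_mul_prod (q ^ 2) (N / 2) k
  rw [prod_range_two_mul, prod_range_two_mul] at h₁
  rw [mul_right_comm (qBinom (q ^ 2) (N / 2) k), h₂, mul_assoc]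
  simp only [← pow_mul, mul_add, mul_one, add_assoc, Nat.reduceAdd] at h₁ ⊢
  rw [h₁]
  split_ifs with hN
  · rw [Nat.even_iff] at hN
    congr 1 <;> refine Finset.prod_congr rfl fun j _ => ?_ <;> congr 2 <;> omega
  · rw [Nat.not_even_iff] at hN
    rw [mul_comm]
    congr 1
    refine Finset.prod_congr rfl fun j _ => ?_
    congr 2
    omega

/-- Formula (3.13): for `2k ≤ N`,
`[N,2k]_q (q; q²)_k = [⌊N/2⌋,k]_{q²} (q^{N-ε(N)}; q^{-2})_k`,
where `ε(N) = 1` if `N` is even and `0` if `N` is odd. -/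
theorem qBinom_two_mul_eq {R : Type*} [CommRing R] (q : R) (N k : ℕ) (hk : 2 * k ≤ N) :
    qBinom q N (2 * k) * ∏ j ∈ Finset.range k, (1 - q ^ (2 * j + 1)) =
      qBinom (q ^ 2) (N / 2) k *
        ∏ j ∈ Finset.range k, (1 - q ^ (N - (if Even N then 1 else 0) - 2 * j)) := by
  have hX : qBinom (Polynomial.X : Polynomial ℤ) N (2 * k) *
        ∏ j ∈ Finset.range k, (1 - Polynomial.X ^ (2 * j + 1)) =
      qBinom (Polynomial.X ^ 2) (N / 2) k * ∏ j ∈ Finset.range k,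
        (1 - Polynomial.X ^ (N - (if Even N then 1 else 0) - 2 * j)) := by
    refine mul_right_cancel₀ ?_ (qBinom_two_mul_eq_mul_prod Polynomial.X N k)
    refine Finset.prod_ne_zero_iff.2 fun j _ h => ?_
    simpa using congrArg (Polynomial.eval 0) h
  have h := congrArg (Polynomial.eval₂RingHom (Int.castRingHom R) q) hX
  simpa only [map_mul, map_prod, map_sub, map_one, map_pow, map_qBinom,
    Polynomial.coe_eval₂RingHom, Polynomial.eval₂_X] using h
end
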